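/- Let a : ℝ → ℝ be monotonically nondecreasing with a(x) > 0 for x > 0, and let v, r ∈ ℝ. If S ⊆ ℝ is a bounded measurable set with 0 < ∫_S max(0, a(x)) dx < ∞, then for every M > 0 there exists z > v + r such that (∫_{v+r}^{z} max(0, a(x)) dx) / (∫_S max(0, a(x)) dx) > M. (The ratio form of the paper's Theorem 1: the open space risk of a monotonic activation exceeds every bound.) -/

import Mathlib

open MeasureTheory

/-- The lower rectangle bound for the integral of a monotone function. -/
theorem Monotone.sub_mul_le_intervalIntegral {g : ℝ → ℝ} (hg : Monotone g) {c z : ℝ}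
    (hcz : c ≤ z) : (z - c) * g c ≤ ∫ x in c..z, g x := by
  have h := intervalIntegral.integral_mono_on (μ := volume) hcz
    intervalIntegrable_const hg.intervalIntegrable (fun x hx => hg hx.1)
  simpa using h

/-- The integral of a nonnegative monotone function that is positive somewhere exceeds every
bound. -/
theorem Monotone.exists_lt_intervalIntegral {g : ℝ → ℝ} (hg : Monotone g) (hg0 : ∀ x, 0 ≤ g x)
    {p : ℝ} (hp : 0 < g p) (b K : ℝ) : ∃ z, b < z ∧ K < ∫ x in b..z, g x := by
  set c := max b p
  have hbc : b ≤ c := le_max_left b p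
  have hc : 0 < g c := hp.trans_le (hg (le_max_right b p))
  have hd : 0 < |K| / g c + 1 := by positivity
  refine ⟨c + (|K| / g c + 1), by linarith, ?_⟩
  rw [← intervalIntegral.integral_add_adjacent_intervals (b := c)
    hg.intervalIntegrable hg.intervalIntegrable]
  have h₁ : 0 ≤ ∫ x in b..c, g x :=
    intervalIntegral.integral_nonneg hbc fun x _ => hg0 x
  have h₂ := hg.sub_mul_le_intervalIntegral (le_add_of_nonneg_right (a := c) hd.le)
  have h₃ : (c + (|K| / g c + 1) - c) * g c = |K| + g c := by
    field_simp
    ring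
  linarith [le_abs_self K]

/-- Ratio form of the paper's Theorem 1: for a classic monotonic activation `a`
(nondecreasing, positive on positives), `v r : ℝ`, and a bounded measurable set `S` on
which the positive part `a⁺ x = max 0 (a x)` is integrable with positive integral, the
open-space-risk ratio `(∫_{v+r}^z a⁺) / (∫_S a⁺)` exceeds every bound `M > 0` for some
`z > v + r`. -/
theorem monotone_activation_risk_ratio_unbounded
    (a : ℝ → ℝ) (ha_mono : Monotone a) (ha_pos : ∀ x : ℝ, 0 < x → 0 < a x)
    (v r : ℝ) (S : Set ℝ) (hS_bdd : Bornology.IsBounded S) (hS_meas : MeasurableSet S)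
    (hS_int : IntegrableOn (fun x => max 0 (a x)) S volume)
    (hS_pos : 0 < ∫ x in S, max 0 (a x)) :
    ∀ M : ℝ, 0 < M → ∃ z : ℝ, v + r < z ∧
      (∫ x in (v + r)..z, max 0 (a x)) / (∫ x in S, max 0 (a x)) > M := by
  intro M _
  have hg : Monotone fun x => max 0 (a x) := monotone_const.max ha_mono
  obtain ⟨z, hz, hlt⟩ := hg.exists_lt_intervalIntegral (fun x => le_max_left 0 (a x))
    (lt_max_of_lt_right (ha_pos 1 one_pos)) (v + r) (M * ∫ x in S, max 0 (a x))
  exact ⟨z, hz, (lt_div_iff₀ hS_pos).mpr hlt⟩
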